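/- arXiv:1509.06009 — 5 statements merged into one kernel-verified Lean document; each statement's English description precedes it below -/
import Mathlib

section
/- There are exactly 30 Fano planes on the set {1,2,3,4,5,6,7}. -/
/-- The point set {1,...,7}. -/
def pts : Finset ℕ := Finset.Icc 1 7

/-- All three-element subsets of {1,...,7}, the candidate lines. -/
def lines : Finset (Finset ℕ) := pts.powersetCard 3

/-- A line {a,b,c} with a < b < c is ordinary if a + b = c. -/
def Ordinary (l : Finset ℕ) : Prop :=
  ∃ a ∈ l, ∃ b ∈ l, ∃ c ∈ l, a < b ∧ b < c ∧ a + b = c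

instance : DecidablePred Ordinary := fun l => by unfold Ordinary; infer_instance

/-- A line is defective if it is not ordinary. -/
def Defective (l : Finset ℕ) : Prop := ¬ Ordinary l

instance : DecidablePred Defective := fun l => by unfold Defective; infer_instance

/-- A Fano plane on {1,...,7}: seven 3-element subsets such that every pair of
distinct points lies on exactly one line. -/
def IsFano (F : Finset (Finset ℕ)) : Prop :=
  F ⊆ lines ∧ F.card = 7 ∧
    ∀ p ∈ pts, ∀ q ∈ pts, p ≠ q →
      (F.filter (fun l => p ∈ l ∧ q ∈ l)).card = 1

instance : DecidablePred IsFano := fun F => by unfold IsFano; infer_instance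

/-- The collection of all Fano planes on {1,...,7}. -/
def fanos : Finset (Finset (Finset ℕ)) := (lines.powersetCard 7).filter IsFano

/-- The order of a point p in a plane F: the number of defective lines of F through p. -/
def order (F : Finset (Finset ℕ)) (p : ℕ) : ℕ :=
  (F.filter (fun l => Defective l ∧ p ∈ l)).card

/-- The number of points of order s in the plane F. -/
def nOrd (F : Finset (Finset ℕ)) (s : ℕ) : ℕ :=
  (pts.filter (fun p => order F p = s)).card

/-- The number of `k`-element subfamilies of a list whose distinct members are pairwise related
by `r`. -/
def cliqueCount {α : Type*} (r : α → α → Bool) : ℕ → List α → ℕ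
  | 0, _ => 1
  | k + 1, l => (l.tails.map fun
    | [] => 0
    | a :: t => cliqueCount r k (t.filter (r a))).sum

/-- The `k`-element subsets of `s` whose distinct members are pairwise related by `r`. -/
def cliques {α : Type*} [DecidableEq α] (r : α → α → Bool) (k : ℕ) (s : Finset α) :
    Finset (Finset α) :=
  (s.powersetCard k).filter fun F => (F : Set α).Pairwise fun a b => r a b

theorem mem_cliques {α : Type*} [DecidableEq α] {r : α → α → Bool} {k : ℕ} {s F : Finset α} :
    F ∈ cliques r k s ↔ (F ⊆ s ∧ F.card = k) ∧ (F : Set α).Pairwise fun a b => r a b := by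
  simp [cliques, Finset.mem_powersetCard]

theorem card_cliques_insert {α : Type*} [DecidableEq α] {r : α → α → Bool}
    [Std.Symm fun a b => (r a b : Prop)] {a : α} {s : Finset α} (ha : a ∉ s) (k : ℕ) :
    (cliques r (k + 1) (insert a s)).card =
      (cliques r (k + 1) s).card + (cliques r k (s.filter fun b => r a b)).card := by
  rw [cliques, Finset.powersetCard_succ_insert ha, Finset.filter_union,
    Finset.card_union_of_disjoint]
  · congr 1
    rw [Finset.filter_image, Finset.card_image_of_injOn]
    · refine congrArg Finset.card (Finset.ext fun F => ?_)
      simp only [mem_cliques, Finset.mem_filter, Finset.mem_powersetCard, Finset.coe_insert,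
        Set.pairwise_insert_of_symm, Finset.subset_iff, Finset.mem_coe]
      grind
    · intro F hF G hG h
      have haF : a ∉ F := fun h => ha ((Finset.mem_powersetCard.1 (Finset.mem_filter.1 hF).1).1 h)
      have haG : a ∉ G := fun h => ha ((Finset.mem_powersetCard.1 (Finset.mem_filter.1 hG).1).1 h)
      rw [← Finset.erase_insert haF, ← Finset.erase_insert haG]
      exact congrArg (fun H => Finset.erase H a) h
  · rw [Finset.disjoint_left]
    intro F hF hF'
    simp only [Finset.mem_filter, Finset.mem_powersetCard, Finset.mem_image] at hF hF'
    obtain ⟨⟨G, -, rfl⟩, -⟩ := hF'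
    exact ha (hF.1.1 (Finset.mem_insert_self a G))

theorem card_cliques_toFinset {α : Type*} [DecidableEq α] {r : α → α → Bool}
    [Std.Symm fun a b => (r a b : Prop)] (k : ℕ) {l : List α} (hl : l.Nodup) :
    (cliques r k l.toFinset).card = cliqueCount r k l := by
  induction k generalizing l with
  | zero => simp [cliques, cliqueCount, Finset.filter_singleton]
  | succ k ihk =>
    induction l with
    | nil => simp [cliques, cliqueCount]
    | cons a l ihl =>
      rw [List.nodup_cons] at hl
      rw [List.toFinset_cons, card_cliques_insert (mt List.mem_toFinset.1 hl.1), ihl hl.2,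
        ← List.toFinset_filter, ihk (hl.2.filter _)]
      simp [cliqueCount, add_comm]

theorem card_filter_mem_mem_offDiag {F : Finset (Finset ℕ)} (hF : F ⊆ lines) :
    ∑ x ∈ pts.offDiag, (F.filter fun l => x.1 ∈ l ∧ x.2 ∈ l).card = F.card * 6 := by
  simp_rw [Finset.card_filter]
  rw [Finset.sum_comm, Finset.sum_const_nat]
  intro l hl
  obtain ⟨hlp, hl3⟩ := Finset.mem_powersetCard.1 (hF hl)
  rw [← Finset.card_filter]
  have : (pts.offDiag.filter fun x => x.1 ∈ l ∧ x.2 ∈ l) = l.offDiag := by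
    ext x
    simp only [Finset.mem_filter, Finset.mem_offDiag]
    have := @hlp x.1
    have := @hlp x.2
    tauto
  rw [this, Finset.offDiag_card, hl3]

/-- Seven lines form a Fano plane exactly when distinct ones meet in at most one point. -/
theorem isFano_iff_pairwise {F : Finset (Finset ℕ)} (hF : F ⊆ lines) (hc : F.card = 7) :
    IsFano F ↔ (F : Set (Finset ℕ)).Pairwise fun l m => (l ∩ m).card ≤ 1 := by
  refine ⟨fun ⟨_, _, h⟩ l hl m hm hlm => ?_, fun h => ⟨hF, hc, fun p hp q hq hpq => ?_⟩⟩
  · by_contra! hlt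
    obtain ⟨p, hp, q, hq, hpq⟩ := Finset.one_lt_card.1 hlt
    rw [Finset.mem_inter] at hp hq
    have hlp := (Finset.mem_powersetCard.1 (hF hl)).1
    obtain ⟨n, hn⟩ := Finset.card_eq_one.1 (h p (hlp hp.1) q (hlp hq.1) hpq)
    have hln : l ∈ ({n} : Finset (Finset ℕ)) := hn ▸ Finset.mem_filter.2 ⟨hl, hp.1, hq.1⟩
    have hmn : m ∈ ({n} : Finset (Finset ℕ)) := hn ▸ Finset.mem_filter.2 ⟨hm, hp.2, hq.2⟩
    exact hlm ((Finset.mem_singleton.1 hln).trans (Finset.mem_singleton.1 hmn).symm)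
  · have hle : ∀ x ∈ pts.offDiag, (F.filter fun l => x.1 ∈ l ∧ x.2 ∈ l).card ≤ 1 := by
      intro x hx
      refine Finset.card_le_one.2 fun l hl m hm => ?_
      rw [Finset.mem_filter] at hl hm
      by_contra hlm
      exact (Finset.mem_offDiag.1 hx).2.2 (Finset.card_le_one.1 (h hl.1 hm.1 hlm) _
        (Finset.mem_inter.2 ⟨hl.2.1, hm.2.1⟩) _ (Finset.mem_inter.2 ⟨hl.2.2, hm.2.2⟩))
    have hsum : ∑ x ∈ pts.offDiag, (F.filter fun l => x.1 ∈ l ∧ x.2 ∈ l).card =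
        ∑ x ∈ pts.offDiag, 1 := by
      rw [card_filter_mem_mem_offDiag hF, hc, ← Finset.card_eq_sum_ones, Finset.offDiag_card]
      rfl
    exact (Finset.sum_eq_sum_iff_of_le hle).1 hsum (p, q) (Finset.mem_offDiag.2 ⟨hp, hq, hpq⟩)

/-- The candidate lines in a list, on which `cliqueCount` can be evaluated. -/
def linesList : List (Finset ℕ) :=
  (List.sublistsLen 3 [1, 2, 3, 4, 5, 6, 7]).map List.toFinset

theorem linesList_toFinset : linesList.toFinset = lines := by
  decide +kernel

theorem linesList_nodup : linesList.Nodup := by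
  decide +kernel

theorem cliqueCount_linesList :
    cliqueCount (fun l m => decide ((l ∩ m).card ≤ 1)) 7 linesList = 30 := by
  decide +kernel

theorem fano_count : fanos.card = 30 := by
  have : Std.Symm fun l m : Finset ℕ => (decide ((l ∩ m).card ≤ 1) : Prop) :=
    ⟨fun l m h => by rwa [Finset.inter_comm]⟩
  rw [← cliqueCount_linesList, ← card_cliques_toFinset _ linesList_nodup, linesList_toFinset]
  refine congrArg Finset.card (Finset.ext fun F => ?_)
  simp only [fanos, mem_cliques, Finset.mem_filter, Finset.mem_powersetCard, decide_eq_true_eq]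
  exact and_congr_right fun h => isFano_iff_pairwise h.1 h.2
end

section
/- Every three-element subset of {1,2,3,4,5,6,7} is a line of exactly 6 of the 30 Fano planes on {1,...,7}. -/
/-- All ways of enlarging the partial plane `G` so that each of the given pairs of points is
covered, by successively adding lines that meet all the previous ones in at most one point. -/
def completions : List (ℕ × ℕ) → Finset (Finset ℕ) → Multiset (Finset (Finset ℕ))
  | [], G => {G}
  | (p, q) :: L, G =>
    if ∃ l ∈ G, p ∈ l ∧ q ∈ l then completions L G
    else (lines.filter fun l => (p ∈ l ∧ q ∈ l) ∧ ∀ m ∈ G, (l ∩ m).card ≤ 1).val.bind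
      fun l => completions L (insert l G)

/-- All pairs `(p, q)` of points with `p < q`. -/
def pointPairs : List (ℕ × ℕ) :=
  ((List.range' 1 7).product (List.range' 1 7)).filter fun x => x.1 < x.2

namespace IsFano

variable {F : Finset (Finset ℕ)}

theorem exists_line (hF : IsFano F) {p q : ℕ} (hp : p ∈ pts) (hq : q ∈ pts) (hpq : p ≠ q) :
    ∃ l ∈ F, p ∈ l ∧ q ∈ l := by
  obtain ⟨l, hl⟩ := Finset.card_pos.1 (Nat.lt_of_lt_of_eq one_pos (hF.2.2 p hp q hq hpq).symm)
  exact ⟨l, Finset.mem_filter.1 hl⟩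

theorem card_inter_le_one (hF : IsFano F) {l m : Finset ℕ} (hl : l ∈ F) (hm : m ∈ F)
    (hlm : l ≠ m) : (l ∩ m).card ≤ 1 := by
  by_contra! h
  obtain ⟨a, ha, b, hb, hab⟩ := Finset.one_lt_card.1 h
  rw [Finset.mem_inter] at ha hb
  have hsub : l ⊆ pts := (Finset.mem_powersetCard.1 (hF.1 hl)).1
  exact hlm (Finset.card_le_one.1 (hF.2.2 a (hsub ha.1) b (hsub hb.1) hab).le
    l (by simp [hl, ha.1, hb.1]) m (by simp [hm, ha.2, hb.2]))

theorem exists_mem_completions_subset (hF : IsFano F) (L : List (ℕ × ℕ))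
    (hL : ∀ x ∈ L, x.1 ∈ pts ∧ x.2 ∈ pts ∧ x.1 ≠ x.2) {G : Finset (Finset ℕ)} (hG : G ⊆ F) :
    ∃ H ∈ completions L G, H ⊆ F := by
  induction L generalizing G with
  | nil => exact ⟨G, Multiset.mem_singleton_self G, hG⟩
  | cons x L ih =>
    obtain ⟨⟨hp, hq, hpq⟩, hL⟩ := List.forall_mem_cons.1 hL
    rw [completions]
    split_ifs with hc
    · exact ih hL hG
    · obtain ⟨l, hl, hpl, hql⟩ := hF.exists_line hp hq hpq
      obtain ⟨H, hH, hHF⟩ := ih hL (Finset.insert_subset hl hG)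
      refine ⟨H, Multiset.mem_bind.2 ⟨l, Finset.mem_filter.2
        ⟨hF.1 hl, ⟨hpl, hql⟩, fun m hm => hF.card_inter_le_one hl (hG hm) ?_⟩, hH⟩, hHF⟩
      rintro rfl
      exact hc ⟨l, hm, hpl, hql⟩

end IsFano

theorem isFano_of_mem_completions : ∀ F ∈ completions pointPairs ∅, IsFano F := by
  decide +kernel

theorem mem_fanos {F : Finset (Finset ℕ)} : F ∈ fanos ↔ IsFano F := by
  simp only [fanos, Finset.mem_filter, Finset.mem_powersetCard, and_iff_right_iff_imp]
  exact fun h => ⟨h.1, h.2.1⟩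

theorem fanos_eq_toFinset_completions : fanos = (completions pointPairs ∅).toFinset := by
  ext F
  rw [mem_fanos, Multiset.mem_toFinset]
  refine ⟨fun hF => ?_, isFano_of_mem_completions F⟩
  obtain ⟨H, hH, hHF⟩ := hF.exists_mem_completions_subset pointPairs (by decide +kernel)
    (Finset.empty_subset F)
  have hcard : F.card ≤ H.card := by rw [hF.2.1, (isFano_of_mem_completions H hH).2.1]
  exact Finset.eq_of_subset_of_card_le hHF hcard ▸ hH

theorem line_in_six_fanos : ∀ l ∈ lines, (fanos.filter (fun F => l ∈ F)).card = 6 := by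
  rw [fanos_eq_toFinset_completions]
  decide +kernel
end

section
/- No Fano plane on {1,2,3,4,5,6,7} has exactly 5 ordinary lines. -/
/-- A set of five ordinary lines either has two lines sharing two points, or there is a pair of
points such that every line through it is an ordinary line outside the set or shares two points
with a different line of the set. -/
theorem five_ordinary_obstruction : ∀ S ∈ (lines.filter Ordinary).powersetCard 5,
    (∃ l ∈ S, ∃ m ∈ S, l ≠ m ∧ 1 < (l ∩ m).card) ∨
    ∃ p ∈ pts, ∃ q ∈ pts, p ≠ q ∧ ∀ l ∈ lines, p ∈ l → q ∈ l →
      (Ordinary l ∧ l ∉ S) ∨ ∃ m ∈ S, l ≠ m ∧ 1 < (l ∩ m).card := by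
  decide +kernel

/-- Distinct lines of a Fano plane share at most one point. -/
theorem IsFano.card_inter_le_one_s6 {F : Finset (Finset ℕ)} (hF : IsFano F) {l m : Finset ℕ}
    (hl : l ∈ F) (hm : m ∈ F) (hne : l ≠ m) : (l ∩ m).card ≤ 1 := by
  by_contra! h
  obtain ⟨p, hp, q, hq, hpq⟩ := Finset.one_lt_card.1 h
  rw [Finset.mem_inter] at hp hq
  have hsub := (Finset.mem_powersetCard.1 (hF.1 hl)).1
  have hcard := hF.2.2 p (hsub hp.1) q (hsub hq.1) hpq
  exact hne (Finset.card_le_one.1 hcard.le l (Finset.mem_filter.2 ⟨hl, hp.1, hq.1⟩)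
    m (Finset.mem_filter.2 ⟨hm, hp.2, hq.2⟩))

theorem no_five_ordinary : ∀ F : Finset (Finset ℕ), IsFano F →
    (F.filter Ordinary).card ≠ 5 := by
  intro F hF h5
  have hS : F.filter Ordinary ∈ (lines.filter Ordinary).powersetCard 5 :=
    Finset.mem_powersetCard.2 ⟨Finset.filter_subset_filter _ hF.1, h5⟩
  rcases five_ordinary_obstruction _ hS with
    ⟨l, hl, m, hm, hne, hlt⟩ | ⟨p, hp, q, hq, hpq, hall⟩
  · exact hlt.not_ge
      (hF.card_inter_le_one_s6 (Finset.mem_filter.1 hl).1 (Finset.mem_filter.1 hm).1 hne)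
  · obtain ⟨l, hl⟩ := Finset.card_pos.1 (hF.2.2 p hp q hq hpq ▸ Nat.one_pos)
    obtain ⟨hlF, hpl, hql⟩ := Finset.mem_filter.1 hl
    rcases hall l (hF.1 hlF) hpl hql with ⟨hord, hnot⟩ | ⟨m, hm, hne, hlt⟩
    · exact hnot (Finset.mem_filter.2 ⟨hlF, hord⟩)
    · exact hlt.not_ge (hF.card_inter_le_one_s6 hlF (Finset.mem_filter.1 hm).1 hne)
end

section
/- There is exactly one Fano plane on {1,2,3,4,5,6,7} containing 6 ordinary lines, namely the plane {123, 145, 167, 246, 257, 347, 356}. -/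
/-- Two distinct lines of a Fano plane share at most one point. -/
theorem IsFano.card_inter_le_one_s8 {F : Finset (Finset ℕ)} (hF : IsFano F) {a b : Finset ℕ}
    (ha : a ∈ F) (hb : b ∈ F) (hab : a ≠ b) : (a ∩ b).card ≤ 1 := by
  by_contra! h
  obtain ⟨p, hp, q, hq, hpq⟩ := Finset.one_lt_card.mp h
  rw [Finset.mem_inter] at hp hq
  have hsub : a ⊆ pts := (Finset.mem_powersetCard.mp (hF.1 ha)).1
  obtain ⟨l, hl⟩ := Finset.card_eq_one.mp (hF.2.2 p (hsub hp.1) q (hsub hq.1) hpq)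
  have hal : a ∈ ({l} : Finset (Finset ℕ)) := hl ▸ Finset.mem_filter.mpr ⟨ha, hp.1, hq.1⟩
  have hbl : b ∈ ({l} : Finset (Finset ℕ)) := hl ▸ Finset.mem_filter.mpr ⟨hb, hp.2, hq.2⟩
  exact hab ((Finset.mem_singleton.mp hal).trans (Finset.mem_singleton.mp hbl).symm)

theorem filter_ordinary_lines : lines.filter Ordinary =
    {{1,2,3}, {1,3,4}, {1,4,5}, {1,5,6}, {1,6,7}, {2,3,5}, {2,4,6}, {2,5,7}, {3,4,7}} := by
  decide +kernel

/-- The only six ordinary lines that pairwise share at most one point. -/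
theorem eq_of_six_ordinary : ∀ O ∈ (({{1,2,3}, {1,3,4}, {1,4,5}, {1,5,6}, {1,6,7}, {2,3,5},
      {2,4,6}, {2,5,7}, {3,4,7}} : Finset (Finset ℕ))).powersetCard 6,
    (∀ a ∈ O, ∀ b ∈ O, a ≠ b → (a ∩ b).card ≤ 1) →
      O = {{1,2,3}, {1,4,5}, {1,6,7}, {2,4,6}, {2,5,7}, {3,4,7}} := by
  decide +kernel

theorem eq_of_isFano_insert : ∀ l ∈ lines,
    IsFano (insert l {{1,2,3}, {1,4,5}, {1,6,7}, {2,4,6}, {2,5,7}, {3,4,7}}) →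
      l = {3,5,6} := by
  decide +kernel

theorem unique_six_ordinary : ∀ F : Finset (Finset ℕ),
    (IsFano F ∧ (F.filter Ordinary).card = 6) ↔
      F = ({{1,2,3}, {1,4,5}, {1,6,7}, {2,4,6}, {2,5,7}, {3,4,7}, {3,5,6}} :
        Finset (Finset ℕ)) := by
  intro F
  constructor
  · rintro ⟨hF, h6⟩
    have hO := eq_of_six_ordinary (F.filter Ordinary)
      (Finset.mem_powersetCard.mpr
        ⟨filter_ordinary_lines ▸ Finset.filter_subset_filter _ hF.1, h6⟩)
      fun a ha b hb => hF.card_inter_le_one_s8 (Finset.mem_filter.mp ha).1 (Finset.mem_filter.mp hb).1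
    have hcard : (F.filter fun l => ¬ Ordinary l).card = 1 := by
      have := Finset.card_filter_add_card_filter_not (s := F) Ordinary
      have := hF.2.1
      omega
    obtain ⟨l, hl⟩ := Finset.card_eq_one.mp hcard
    have hlF : l ∈ F := (Finset.mem_filter.mp (hl ▸ Finset.mem_singleton_self l)).1
    have hFl : F = insert l {{1,2,3}, {1,4,5}, {1,6,7}, {2,4,6}, {2,5,7}, {3,4,7}} := by
      rw [← hO, Finset.insert_eq, ← hl, Finset.union_comm, Finset.filter_union_filter_not_eq]
    have hl_eq := eq_of_isFano_insert l (hF.1 hlF) (hFl ▸ hF)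
    rw [hFl, hl_eq]
    decide +kernel
  · rintro rfl
    decide +kernel
end

section
/- Exactly 7 of the 30 Fano planes on {1,2,3,4,5,6,7} contain exactly one ordinary line. -/
/-- All ways to add to the partial plane `T` a line through `p` and `q` whose third point is not yet
joined to `p` or `q`; `T` itself if `p` and `q` are already joined. -/
def joinPair (p q : ℕ) (T : Finset (Finset ℕ)) : List (Finset (Finset ℕ)) :=
  if ∃ l ∈ T, p ∈ l ∧ q ∈ l then [T] else
    ((List.range' 1 7).filter fun r =>
      r ≠ p ∧ r ≠ q ∧ ∀ l ∈ T, r ∈ l → p ∉ l ∧ q ∉ l).map fun r => insert {p, q, r} T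

/-- The partial planes obtained from `T` by joining the given pairs of points one after another. -/
def joinPairs : List (ℕ × ℕ) → Finset (Finset ℕ) → List (Finset (Finset ℕ))
  | [], T => [T]
  | (p, q) :: ps, T => (joinPair p q T).flatMap (joinPairs ps)

/-- The pairs `(p, q)` with `1 ≤ p < q ≤ 7`. -/
def pairs : List (ℕ × ℕ) :=
  ((List.range' 1 7).product (List.range' 1 7)).filter fun x => x.1 < x.2

theorem IsFano.existsUnique_line {F : Finset (Finset ℕ)} (hF : IsFano F) {p q : ℕ}
    (hp : p ∈ pts) (hq : q ∈ pts) (hpq : p ≠ q) : ∃! l, l ∈ F ∧ p ∈ l ∧ q ∈ l := by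
  obtain ⟨l, hl⟩ := Finset.card_eq_one.mp (hF.2.2 p hp q hq hpq)
  have mem_iff (m) : (m ∈ F ∧ p ∈ m ∧ q ∈ m) ↔ m = l := by
    rw [← Finset.mem_singleton, ← hl, Finset.mem_filter]
  exact ⟨l, (mem_iff l).2 rfl, fun m hm => (mem_iff m).1 hm⟩

theorem IsFano.exists_joinPair_subset {F T : Finset (Finset ℕ)} (hF : IsFano F) {p q : ℕ}
    (hp : p ∈ pts) (hq : q ∈ pts) (hpq : p ≠ q) (hT : T ⊆ F) :
    ∃ T' ∈ joinPair p q T, T' ⊆ F := by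
  unfold joinPair
  split_ifs with h
  · exact ⟨T, by simp, hT⟩
  · push Not at h
    obtain ⟨l, ⟨hl, hpl, hql⟩, -⟩ := hF.existsUnique_line hp hq hpq
    obtain ⟨hsub, hcard⟩ := Finset.mem_powersetCard.mp (hF.1 hl)
    obtain ⟨r, hr⟩ : ∃ r, r ∈ l \ {p, q} := by
      apply Finset.Nonempty.exists_mem
      rw [← Finset.card_pos]
      have := Finset.le_card_sdiff {p, q} l
      have := Finset.card_le_two (a := p) (b := q)
      omega
    simp only [Finset.mem_sdiff, Finset.mem_insert, Finset.mem_singleton, not_or] at hr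
    obtain ⟨hrl, hrp, hrq⟩ := hr
    have hrpts := hsub hrl
    have hl_eq : {p, q, r} = l := by
      apply Finset.eq_of_subset_of_card_le
      · simp [Finset.insert_subset_iff, *]
      · rw [hcard, Finset.card_eq_three.mpr ⟨p, q, r, hpq, (Ne.symm hrp), (Ne.symm hrq), rfl⟩]
    refine ⟨insert {p, q, r} T, List.mem_map.mpr ⟨r, ?_, rfl⟩, ?_⟩
    · have hr7 := Finset.mem_Icc.mp hrpts
      simp only [List.mem_filter, List.mem_range'_1, decide_eq_true_eq]
      refine ⟨by omega, hrp, hrq, fun m hm hrm => ⟨fun hpm => ?_, fun hqm => ?_⟩⟩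
      · obtain rfl := (hF.existsUnique_line hp hrpts (Ne.symm hrp)).unique
          ⟨hT hm, hpm, hrm⟩ ⟨hl, hpl, hrl⟩
        exact h m hm hpm hql
      · obtain rfl := (hF.existsUnique_line hq hrpts (Ne.symm hrq)).unique
          ⟨hT hm, hqm, hrm⟩ ⟨hl, hql, hrl⟩
        exact h m hm hpl hqm
    · rw [hl_eq]
      exact Finset.insert_subset hl hT

theorem IsFano.exists_joinPairs_subset {F : Finset (Finset ℕ)} (hF : IsFano F)
    (ps : List (ℕ × ℕ)) (hps : ∀ x ∈ ps, x.1 ∈ pts ∧ x.2 ∈ pts ∧ x.1 ≠ x.2)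
    (T : Finset (Finset ℕ)) (hT : T ⊆ F) : ∃ T' ∈ joinPairs ps T, T' ⊆ F := by
  induction ps generalizing T with
  | nil => exact ⟨T, by simp [joinPairs], hT⟩
  | cons x ps ih =>
    obtain ⟨hp, hq, hpq⟩ := hps x List.mem_cons_self
    obtain ⟨U, hU, hUF⟩ := hF.exists_joinPair_subset hp hq hpq hT
    obtain ⟨T', hT', hF'⟩ := ih (fun y hy => hps y (List.mem_cons_of_mem _ hy)) U hUF
    exact ⟨T', List.mem_flatMap.mpr ⟨U, hU, hT'⟩, hF'⟩

theorem isFano_of_mem_joinPairs : ∀ T ∈ joinPairs pairs ∅, IsFano T := by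
  decide +kernel

theorem mem_fanos_iff_mem_joinPairs (F : Finset (Finset ℕ)) :
    F ∈ fanos ↔ F ∈ joinPairs pairs ∅ := by
  simp only [fanos, Finset.mem_filter, Finset.mem_powersetCard]
  refine ⟨fun ⟨_, hF⟩ => ?_, fun h => ?_⟩
  · obtain ⟨T, hT, hTF⟩ := hF.exists_joinPairs_subset pairs (by decide +kernel) ∅
      (Finset.empty_subset F)
    have hcard := (isFano_of_mem_joinPairs T hT).2.1
    rwa [← Finset.eq_of_subset_of_card_le hTF (by rw [hcard, hF.2.1])]
  · have hF := isFano_of_mem_joinPairs F h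
    exact ⟨⟨hF.1, hF.2.1⟩, hF⟩

theorem one_ordinary_count :
    (fanos.filter (fun F => (F.filter Ordinary).card = 1)).card = 7 := by
  have h : fanos.filter (fun F => (F.filter Ordinary).card = 1) =
      ((joinPairs pairs ∅).filter fun F => (F.filter Ordinary).card = 1).toFinset := by
    ext F
    simp [mem_fanos_iff_mem_joinPairs]
  rw [h]
  decide +kernel
end
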